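/- There exist an absolute constant c > 0 and an absolute constant p₀ such that for every prime p ≥ p₀ and every set A ⊆ F_p \ {0} with 2 ≤ |A| and |A|² < p, one has max(|A:A|, |A+A|) ≥ c · |A|^{1+1/11}. -/

import Mathlib

open Pointwise

open Finset in
/-- If every large subset of `X` contains a nonempty `X'` with `φ X' ≤ M * #X'`, and `φ` is
subadditive, then some subset of `X` with at least half the elements has this property. -/
lemma exists_half_subset_le_mul_card {α : Type*} [DecidableEq α] (X : Finset α)
    (φ : Finset α → ℝ) (M : ℝ) (h0 : φ ∅ = 0) (hsub : ∀ U V, φ (U ∪ V) ≤ φ U + φ V)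
    (h : ∀ Z ⊆ X, Z.Nonempty → #X ≤ 2 * #Z → ∃ X' ⊆ Z, X'.Nonempty ∧ φ X' ≤ M * #X') :
    ∃ U ⊆ X, #X ≤ 2 * #U ∧ φ U ≤ M * #U := by
  obtain ⟨U, hU, hmax⟩ := exists_max_image (X.powerset.filter fun U => φ U ≤ M * #U) card
    ⟨∅, by simp [h0]⟩
  simp only [mem_filter, mem_powerset] at hU hmax
  refine ⟨U, hU.1, ?_, hU.2⟩
  by_contra! hlt
  have hcard := card_sdiff_add_card_eq_card hU.1
  obtain ⟨X', hX', hne, hφ⟩ := h (X \ U) sdiff_subset (card_pos.1 (by omega)) (by omega)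
  have hdisj : Disjoint U X' := (disjoint_sdiff).mono_right hX'
  have hun : #(U ∪ X') = #U + #X' := card_union_of_disjoint hdisj
  have := hmax (U ∪ X') ⟨union_subset hU.1 (hX'.trans sdiff_subset), by
    rw [hun]; push_cast; linarith [hsub U X', hU.2]⟩
  have := hne.card_pos
  omega

section Pluennecke

open Finset

variable {G : Type*} [AddCommGroup G] [DecidableEq G]

/-- The Plünnecke-Petridis inequality, with the minimising subset extracted. -/
lemma exists_subset_forall_card_add_add_mul_card_le {X : Finset G} (hX : X.Nonempty)
    (B : Finset G) :
    ∃ X' ⊆ X, X'.Nonempty ∧ ∀ S : Finset G, #(S + X' + B) * #X ≤ #(X + B) * #(S + X') := by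
  obtain ⟨X', hX', hmin⟩ := exists_min_image (X.powerset.erase ∅)
    (fun U ↦ (#(U + B) / #U : ℚ)) ⟨X, by simp [hX.ne_empty]⟩
  have hle : ∀ U ⊆ X, #(X' + B) * #U ≤ #(U + B) * #X' := by
    intro U hU
    obtain rfl | hne := U.eq_empty_or_nonempty
    · simp
    have h := hmin U (by simp [hne.ne_empty, hU])
    rw [mem_erase, ← nonempty_iff_ne_empty] at hX'
    rw [div_le_div_iff₀ (by exact_mod_cast hX'.1.card_pos) (by exact_mod_cast hne.card_pos)] at h
    exact_mod_cast h
  rw [mem_erase, ← nonempty_iff_ne_empty, mem_powerset] at hX'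
  refine ⟨X', hX'.2, hX'.1, fun S => ?_⟩
  have h1 := pluennecke_petridis_inequality_add S fun U hU => hle U (hU.trans hX'.2)
  have h2 := hle X Subset.rfl
  refine Nat.le_of_mul_le_mul_right ?_ hX'.1.card_pos
  calc #(S + X' + B) * #X * #X' = #(S + X' + B) * #X' * #X := by ring
    _ ≤ #(X' + B) * #(S + X') * #X := by gcongr
    _ = #(X' + B) * #X * #(S + X') := by ring
    _ ≤ #(X + B) * #X' * #(S + X') := by gcongr
    _ = _ := by ring

lemma exists_subset_card_add_three_le {X : Finset G} (hX : X.Nonempty) (B : Finset G) :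
    ∃ X' ⊆ X, X'.Nonempty ∧ #(X' + B + B + B) * #X ^ 3 ≤ #(X + B) ^ 3 * #X' := by
  obtain ⟨X', hX', hne, h⟩ := exists_subset_forall_card_add_add_mul_card_le hX B
  refine ⟨X', hX', hne, ?_⟩
  have h1 := h {0}
  have h2 := h B
  have h3 := h (B + B)
  rw [singleton_zero, zero_add] at h1
  rw [show B + B + X' + B = X' + B + B + B by abel] at h3
  rw [show B + B + X' = B + X' + B by abel] at h3
  rw [add_comm B X'] at h2 h3
  calc #(X' + B + B + B) * #X ^ 3 = #(X' + B + B + B) * #X * #X ^ 2 := by ring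
    _ ≤ #(X + B) * #(X' + B + B) * #X ^ 2 := by gcongr
    _ = #(X + B) * #X * (#(X' + B + B) * #X) := by ring
    _ ≤ #(X + B) * #X * (#(X + B) * #(X' + B)) := by gcongr
    _ = #(X + B) ^ 2 * (#(X' + B) * #X) := by ring
    _ ≤ #(X + B) ^ 2 * (#(X + B) * #X') := by gcongr
    _ = _ := by ring

/-- Plünnecke's inequality for two different summands, up to a factor `4`. -/
lemma exists_subset_card_add_add_le {X : Finset G} (hX : X.Nonempty) (Y₁ Y₂ : Finset G) :
    ∃ X' ⊆ X, X'.Nonempty ∧ #(X' + Y₁ + Y₂) * #X ^ 2 ≤ 4 * #(X + Y₁) * #(X + Y₂) * #X' := by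
  obtain rfl | hY₁ := Y₁.eq_empty_or_nonempty
  · exact ⟨X, Subset.rfl, hX, by simp⟩
  obtain rfl | hY₂ := Y₂.eq_empty_or_nonempty
  · exact ⟨X, Subset.rfl, hX, by simp⟩
  set s₁ := #(X + Y₁)
  set s₂ := #(X + Y₂)
  have hs₁ : 0 < s₁ := (hX.add hY₁).card_pos
  have hs₂ : 0 < s₂ := (hX.add hY₂).card_pos
  set T₁ : Finset ℤ := Ico 0 (s₂ : ℤ)
  set T₂ : Finset ℤ := Ico 0 (s₁ : ℤ)
  have hT₁ : #T₁ = s₂ := by simp [T₁]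
  have hT₂ : #T₂ = s₁ := by simp [T₂]
  set Y : Finset (G × ℤ × ℤ) := Y₁ ×ˢ (T₁ ×ˢ {0}) ∪ Y₂ ×ˢ ({0} ×ˢ T₂)
  have hXY : #(X ×ˢ {(0 : ℤ × ℤ)} + Y) ≤ 2 * (s₁ * s₂) := by
    rw [add_union, product_add_product_comm, product_add_product_comm]
    refine (card_union_le _ _).trans ?_
    simp only [singleton_zero, zero_add, card_product, card_zero, mul_one, one_mul, hT₁, hT₂]
    change s₁ * s₂ + s₂ * s₁ ≤ _
    linarith
  obtain ⟨W, hW, hWne, h⟩ := exists_subset_forall_card_add_add_mul_card_le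
    (X := X ×ˢ {(0 : ℤ × ℤ)}) (hX.product (singleton_nonempty _)) Y
  set X' := W.image Prod.fst
  have hWX' : W = X' ×ˢ {(0 : ℤ × ℤ)} := by
    ext ⟨a, b⟩
    rw [mem_product, mem_singleton, mem_image]
    constructor
    · intro hab
      exact ⟨⟨_, hab, rfl⟩, by simpa using (mem_product.1 (hW hab)).2⟩
    · rintro ⟨⟨w, hw, hwa⟩, hb⟩
      have : w.2 = 0 := by simpa using (mem_product.1 (hW hw)).2
      rwa [show (a, b) = w from Prod.ext hwa.symm (hb.trans this.symm)]
  have hcW : #W = #X' := by rw [hWX']; simp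
  refine ⟨X', ?_, hWne.image _, ?_⟩
  · intro a ha
    obtain ⟨w, hw, rfl⟩ := mem_image.1 ha
    exact (mem_product.1 (hW hw)).1
  have h1 := h {0}
  have h2 := h Y
  rw [singleton_zero, zero_add] at h1
  rw [card_product, card_singleton, mul_one] at h1 h2
  rw [hcW] at h1
  rw [add_comm Y W] at h2
  have h3 : #(X' + Y₁ + Y₂) * (s₂ * s₁) ≤ #(W + Y + Y) := by
    calc #(X' + Y₁ + Y₂) * (s₂ * s₁)
        = #((X' ×ˢ {(0 : ℤ × ℤ)} + Y₁ ×ˢ (T₁ ×ˢ {0})) + Y₂ ×ˢ ({0} ×ˢ T₂)) := by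
          rw [product_add_product_comm, product_add_product_comm, singleton_zero (α := ℤ × ℤ),
            zero_add, product_add_product_comm]
          simp [singleton_zero, hT₁, hT₂]
      _ ≤ _ := by
        rw [hWX']
        refine card_le_card (add_subset_add (add_subset_add Subset.rfl ?_) ?_)
        · exact subset_union_left
        · exact subset_union_right
  refine Nat.le_of_mul_le_mul_right ?_ (Nat.mul_pos hs₂ hs₁)
  calc #(X' + Y₁ + Y₂) * #X ^ 2 * (s₂ * s₁)
      = #(X' + Y₁ + Y₂) * (s₂ * s₁) * #X * #X := by ring
    _ ≤ #(W + Y + Y) * #X * #X := by gcongr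
    _ ≤ 2 * (s₁ * s₂) * #(W + Y) * #X :=
      Nat.mul_le_mul_right _ (h2.trans (Nat.mul_le_mul_right _ hXY))
    _ = 2 * (s₁ * s₂) * (#(W + Y) * #X) := by ring
    _ ≤ 2 * (s₁ * s₂) * (2 * (s₁ * s₂) * #X') :=
      Nat.mul_le_mul_left _ (h1.trans (Nat.mul_le_mul_right _ hXY))
    _ = _ := by ring

/-- A subset `U` of `X` of at least half its size with `U + B + B + B` small. -/
lemma exists_half_subset_card_add_three_le {X : Finset G} (B : Finset G) :
    ∃ U ⊆ X, #X ≤ 2 * #U ∧ (#(U + B + B + B) : ℝ) * #X ^ 3 ≤ 8 * #(X + B) ^ 3 * #U := by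
  refine exists_half_subset_le_mul_card X (fun U => (#(U + B + B + B) : ℝ) * #X ^ 3) _
    (by simp) (fun U V => ?_) fun Z hZ hne hc => ?_
  · simp only [union_add]
    rw [← add_mul]
    gcongr
    exact_mod_cast card_union_le _ _
  obtain ⟨X', hX', hne', h⟩ := exists_subset_card_add_three_le hne B
  refine ⟨X', hX', hne', ?_⟩
  have : #(X' + B + B + B) * #X ^ 3 ≤ 8 * #(X + B) ^ 3 * #X' := by
    calc #(X' + B + B + B) * #X ^ 3 ≤ #(X' + B + B + B) * (2 * #Z) ^ 3 := by gcongr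
      _ = 8 * (#(X' + B + B + B) * #Z ^ 3) := by ring
      _ ≤ 8 * (#(Z + B) ^ 3 * #X') := by gcongr
      _ ≤ 8 * (#(X + B) ^ 3 * #X') := by gcongr
      _ = _ := by ring
  exact_mod_cast this

lemma exists_half_subset_card_add_add_le {X : Finset G} (Y₁ Y₂ : Finset G) :
    ∃ U ⊆ X, #X ≤ 2 * #U ∧
      (#(U + Y₁ + Y₂) : ℝ) * #X ^ 2 ≤ 16 * #(X + Y₁) * #(X + Y₂) * #U := by
  refine exists_half_subset_le_mul_card X (fun U => (#(U + Y₁ + Y₂) : ℝ) * #X ^ 2) _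
    (by simp) (fun U V => ?_) fun Z hZ hne hc => ?_
  · simp only [union_add]
    rw [← add_mul]
    gcongr
    exact_mod_cast card_union_le _ _
  obtain ⟨X', hX', hne', h⟩ := exists_subset_card_add_add_le hne Y₁ Y₂
  refine ⟨X', hX', hne', ?_⟩
  have : #(X' + Y₁ + Y₂) * #X ^ 2 ≤ 16 * #(X + Y₁) * #(X + Y₂) * #X' := by
    calc #(X' + Y₁ + Y₂) * #X ^ 2 ≤ #(X' + Y₁ + Y₂) * (2 * #Z) ^ 2 := by gcongr
      _ = 4 * (#(X' + Y₁ + Y₂) * #Z ^ 2) := by ring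
      _ ≤ 4 * (4 * #(Z + Y₁) * #(Z + Y₂) * #X') := by gcongr
      _ ≤ 4 * (4 * #(X + Y₁) * #(X + Y₂) * #X') := by gcongr
      _ = _ := by ring
  exact_mod_cast this

end Pluennecke

section Field

open Finset

/-- If `A ∩ ξA` is large for a typical ratio `ξ` then we can choose a reference element `x` such
that `bA ∩ xA` is large for most `b ∈ A`, robustly. -/
lemma exists_popular_subsets {F : Type*} [Field F] [DecidableEq F] (A : Finset F)
    (hA : ∀ a ∈ A, a ≠ 0) (hne : A.Nonempty) {n : ℝ} (hn : 0 < n)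
    (hq : 8 * (n * #(A / A)) ≤ (#A : ℝ) ^ 2) :
    ∃ x ∈ A, ∃ B ⊆ A, ∃ C ⊆ B, #A ≤ 2 * #C ∧
      (∀ b ∈ B, n ≤ #{w ∈ A | b * w ∈ x • A}) ∧
      ∀ c ∈ C, n / 2 ≤ #{w ∈ B | c * w ∈ x • A} := by
  have hfib : ∀ ξ ∈ A / A, (#{z ∈ {z ∈ A ×ˢ A | (#{w ∈ A | z.2 * w ∈ z.1 • A} : ℝ) < n} |
      z.2 / z.1 = ξ} : ℝ) ≤ n := by
    intro ξ _
    by_contra! hlt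
    obtain ⟨z, hz⟩ := card_pos.1 (Nat.cast_pos.1 (hn.trans hlt))
    refine absurd hlt (not_lt.2 ?_)
    simp only [mem_filter, mem_product] at hz
    refine le_trans ?_ hz.1.2.le
    rw [Nat.cast_le]
    refine card_le_card_of_injOn Prod.fst ?_ ?_
    · intro y hy
      simp only [coe_filter, mem_filter, mem_product, Set.mem_ofPred_eq] at hy ⊢
      refine ⟨hy.1.1.1, mem_smul_finset.2 ⟨y.2, hy.1.1.2, ?_⟩⟩
      have h1 := hA _ hy.1.1.1
      have h2 := hA _ hz.1.1.1
      have := hy.2.trans hz.2.symm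
      rw [div_eq_div_iff h1 h2] at this
      rw [smul_eq_mul, mul_comm, this]
    · intro y hy y' hy' h
      simp only [coe_filter, mem_filter, mem_product, Set.mem_ofPred_eq] at hy hy'
      have h1 := hA _ hy.1.1.1
      have := hy.2.trans hy'.2.symm
      rw [← h, div_left_inj' h1] at this
      exact Prod.ext h this
  have hU : (#{z ∈ A ×ˢ A | (#{w ∈ A | z.2 * w ∈ z.1 • A} : ℝ) < n} : ℝ) ≤ n * #(A / A) := by
    rw [card_eq_sum_card_fiberwise (f := fun z => z.2 / z.1) (t := A / A)]
    · push_cast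
      refine (sum_le_sum hfib).trans ?_
      rw [sum_const, nsmul_eq_mul, mul_comm]
    · intro z hz
      simp only [coe_filter, mem_product, Set.mem_ofPred_eq] at hz
      exact div_mem_div hz.1.2 hz.1.1
  rw [card_filter, sum_product] at hU
  simp only [← card_filter] at hU
  obtain ⟨x, hx, hxc⟩ : ∃ x ∈ A,
      (#{c ∈ A | (#{w ∈ A | c * w ∈ x • A} : ℝ) < n} : ℝ) ≤ #A / 8 := by
    refine exists_le_of_sum_le hne ?_
    rw [sum_const, nsmul_eq_mul]
    push_cast at hU
    linarith
  set B := {b ∈ A | n ≤ #{w ∈ A | b * w ∈ x • A}} with hB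
  set C := {c ∈ B | n / 2 ≤ #{w ∈ B | c * w ∈ x • A}} with hC
  have hBA : B ⊆ A := filter_subset _ _
  have hCB : C ⊆ B := filter_subset _ _
  have hAB : (#(A \ B) : ℝ) ≤ #A / 8 := by
    refine le_trans ?_ hxc
    rw [Nat.cast_le]
    refine card_le_card fun c hc => ?_
    simp only [hB, mem_sdiff, mem_filter, not_and, not_le] at hc ⊢
    exact ⟨hc.1, hc.2 hc.1⟩
  have hrow : ∀ c ∈ B \ C, n / 2 ≤ (#{w ∈ A \ B | c * w ∈ x • A} : ℝ) := by
    intro c hc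
    rw [mem_sdiff] at hc
    have h1 : n ≤ #{w ∈ A | c * w ∈ x • A} := (mem_filter.1 hc.1).2
    have h2 : (#{w ∈ B | c * w ∈ x • A} : ℝ) < n / 2 := by
      by_contra! h
      exact hc.2 (mem_filter.2 ⟨hc.1, h⟩)
    have h3 : #{w ∈ A | c * w ∈ x • A} =
        #{w ∈ A \ B | c * w ∈ x • A} + #{w ∈ B | c * w ∈ x • A} := by
      rw [← card_union_of_disjoint, ← filter_union, sdiff_union_of_subset hBA]
      exact disjoint_filter_filter sdiff_disjoint
    rw [h3] at h1
    push_cast at h1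
    linarith
  have hcol : ∀ w ∈ A \ B, (#{c ∈ B \ C | c * w ∈ x • A} : ℝ) ≤ n := by
    intro w hw
    rw [mem_sdiff] at hw
    have h2 : (#{c ∈ A | w * c ∈ x • A} : ℝ) < n := by
      by_contra! h
      exact hw.2 (mem_filter.2 ⟨hw.1, h⟩)
    refine le_trans ?_ h2.le
    rw [Nat.cast_le]
    refine card_le_card fun c hc => ?_
    rw [mem_filter] at hc ⊢
    rw [mul_comm]
    exact ⟨hBA (mem_sdiff.1 hc.1).1, hc.2⟩
  have hdc : #(B \ C) * (n / 2) ≤ #(A \ B) * n := by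
    have h := sum_card_bipartiteAbove_eq_sum_card_bipartiteBelow (s := B \ C) (t := A \ B)
      (fun c w => c * w ∈ x • A)
    calc #(B \ C) * (n / 2) ≤ ∑ c ∈ B \ C, (#{w ∈ A \ B | c * w ∈ x • A} : ℝ) := by
          rw [← nsmul_eq_mul, ← sum_const]
          exact sum_le_sum hrow
      _ = ∑ w ∈ A \ B, (#{c ∈ B \ C | c * w ∈ x • A} : ℝ) := by exact_mod_cast h
      _ ≤ #(A \ B) * n := by
          rw [← nsmul_eq_mul, ← sum_const]
          exact sum_le_sum hcol
  have hBC : (#(B \ C) : ℝ) ≤ 2 * #(A \ B) := by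
    refine le_of_mul_le_mul_right ?_ hn
    linarith
  refine ⟨x, hx, B, hBA, C, hCB, ?_, fun b hb => (mem_filter.1 hb).2,
    fun c hc => (mem_filter.1 hc).2⟩
  have e1 : (#(A \ B) : ℝ) + #B = #A := by exact_mod_cast card_sdiff_add_card_eq_card hBA
  have e2 : (#(B \ C) : ℝ) + #C = #B := by exact_mod_cast card_sdiff_add_card_eq_card hCB
  have : (#A : ℝ) ≤ 2 * #C := by
    have : (0 : ℝ) ≤ #A := by positivity
    linarith
  exact_mod_cast this

variable {F : Type*} [Field F] [DecidableEq F]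

/-- If `bA ∩ xA` is large and `A + A` is small, then `bA` can be replaced by `xA` in sumsets and
difference sets. -/
lemma card_add_smul_mul_le_and_card_sub_smul_mul_le {A Z : Finset F} {x b : F} {n M : ℝ}
    (hn : n ≤ #Z) (hM : #(A + A) ≤ M) (hx : Z ⊆ x • A) (hb : Z ⊆ b • A) (S : Finset F) :
    #(S + b • A) * n ≤ #(S + x • A) * M ∧ #(S - b • A) * n ≤ #(S + x • A) * M := by
  have hbA : #(b • A + b • A) ≤ #(A + A) := by
    rw [← smul_add]
    exact card_image_le
  have key : (#(S + Z) * #(b • A + Z) : ℝ) ≤ #(S + x • A) * M := by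
    have h1 : #(S + Z) ≤ #(S + x • A) := card_le_card (add_subset_add_left hx)
    have h2 : #(b • A + Z) ≤ #(A + A) := (card_le_card (add_subset_add_left hb)).trans hbA
    refine mul_le_mul (by exact_mod_cast h1) (le_trans (by exact_mod_cast h2) hM)
      (by positivity) (by positivity)
  constructor
  · have h := ruzsa_triangle_inequality_add_add_add S Z (b • A)
    rw [add_comm Z] at h
    calc (#(S + b • A) : ℝ) * n ≤ #(S + b • A) * #Z := by gcongr
      _ ≤ #(S + Z) * #(b • A + Z) := by exact_mod_cast h
      _ ≤ _ := key
  · have h := ruzsa_triangle_inequality_sub_add_add S Z (b • A)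
    calc (#(S - b • A) : ℝ) * n ≤ #(S - b • A) * #Z := by gcongr
      _ ≤ #(S + Z) * #(b • A + Z) := by exact_mod_cast h
      _ ≤ _ := key

lemma card_add_div_smul_mul_pow_le {A A' C W : Finset F} {x c₁ c₂ b₁ b₂ : F} {n M : ℝ}
    (hn : 0 ≤ n) (hM : #(A + A) ≤ M)
    (hC : C ⊆ A) (hW : W ⊆ A) (hne : b₁ ≠ b₂) (hWx : c₁ • W ⊆ x • A')
    (hc₂ : ∃ Z : Finset F, n ≤ #Z ∧ Z ⊆ x • A ∧ Z ⊆ c₂ • A)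
    (hb₁ : ∃ Z : Finset F, n ≤ #Z ∧ Z ⊆ x • A ∧ Z ⊆ b₁ • A)
    (hb₂ : ∃ Z : Finset F, n ≤ #Z ∧ Z ⊆ x • A ∧ Z ⊆ b₂ • A) :
    #(C + ((c₁ - c₂) / (b₁ - b₂)) • W) * n ^ 3 ≤ #(A' + A + A + A) * M ^ 3 := by
  obtain ⟨Z₂, hn₂, hx₂, hz₂⟩ := hc₂
  obtain ⟨Z₃, hn₃, hx₃, hz₃⟩ := hb₁
  obtain ⟨Z₄, hn₄, hx₄, hz₄⟩ := hb₂
  have hM0 : 0 ≤ M := le_trans (by positivity) hM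
  have hd : b₁ - b₂ ≠ 0 := sub_ne_zero.2 hne
  have h0 : #(C + ((c₁ - c₂) / (b₁ - b₂)) • W) ≤
      #(c₁ • W + b₁ • A - c₂ • A - b₂ • A) := by
    refine card_le_card_of_injOn (fun y => (b₁ - b₂) * y) ?_
      ((mul_right_injective₀ hd).injOn)
    intro y hy
    obtain ⟨u, hu, v, hv, rfl⟩ := mem_add.1 hy
    obtain ⟨w, hw, rfl⟩ := mem_smul_finset.1 hv
    have e : (b₁ - b₂) * (u + ((c₁ - c₂) / (b₁ - b₂)) • w) =
        c₁ * w + b₁ * u - c₂ * w - b₂ * u := by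
      rw [smul_eq_mul]
      field_simp
      ring
    simp only [e]
    exact sub_mem_sub (sub_mem_sub (add_mem_add (smul_mem_smul_finset hw)
      (smul_mem_smul_finset (hC hu))) (smul_mem_smul_finset (hW hw)))
      (smul_mem_smul_finset (hC hu))
  have h1 := (card_add_smul_mul_le_and_card_sub_smul_mul_le hn₄ hM hx₄ hz₄
    (c₁ • W + b₁ • A - c₂ • A)).2
  have h2 := (card_add_smul_mul_le_and_card_sub_smul_mul_le hn₂ hM hx₂ hz₂
    (c₁ • W + b₁ • A + x • A)).2
  have h3 := (card_add_smul_mul_le_and_card_sub_smul_mul_le hn₃ hM hx₃ hz₃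
    (c₁ • W + x • A + x • A)).1
  rw [show c₁ • W + b₁ • A - c₂ • A + x • A = c₁ • W + b₁ • A + x • A - c₂ • A by
    rw [sub_eq_add_neg, sub_eq_add_neg, add_right_comm]] at h1
  rw [show c₁ • W + x • A + x • A + b₁ • A = c₁ • W + b₁ • A + x • A + x • A by abel] at h3
  have h4 : #(c₁ • W + x • A + x • A + x • A) ≤ #(A' + A + A + A) := by
    refine le_trans (card_le_card (t := x • (A' + A + A + A)) ?_) card_image_le
    simp only [smul_add]
    gcongr
  calc (#(C + ((c₁ - c₂) / (b₁ - b₂)) • W) : ℝ) * n ^ 3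
      ≤ #(c₁ • W + b₁ • A - c₂ • A - b₂ • A) * n ^ 3 := by gcongr
    _ = #(c₁ • W + b₁ • A - c₂ • A - b₂ • A) * n * n ^ 2 := by ring
    _ ≤ #(c₁ • W + b₁ • A + x • A - c₂ • A) * M * n ^ 2 := by gcongr
    _ = #(c₁ • W + b₁ • A + x • A - c₂ • A) * n * (M * n) := by ring
    _ ≤ #(c₁ • W + b₁ • A + x • A + x • A) * M * (M * n) := by gcongr
    _ = #(c₁ • W + b₁ • A + x • A + x • A) * n * M ^ 2 := by ring
    _ ≤ #(c₁ • W + x • A + x • A + x • A) * M * M ^ 2 := by gcongr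
    _ = #(c₁ • W + x • A + x • A + x • A) * M ^ 3 := by ring
    _ ≤ _ := by gcongr

end Field

section ZMod

open Finset

variable {p : ℕ} [Fact p.Prime]

/-- Either every element of `ZMod p` is a ratio of differences `(C - C) / (B - B)`, or there is a
ratio of differences `r` such that `1 + r` is not one. -/
lemma forall_or_exists_one_add_of_ratio_of_differences {B C : Finset (ZMod p)} (hC : C.Nonempty)
    (hB : 1 < #B) :
    (∀ r : ZMod p, ∃ c₁ ∈ C, ∃ c₂ ∈ C, ∃ b₁ ∈ B, ∃ b₂ ∈ B, b₁ ≠ b₂ ∧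
      r = (c₁ - c₂) / (b₁ - b₂)) ∨
    ∃ c₁ ∈ C, ∃ c₂ ∈ C, ∃ b₁ ∈ B, ∃ b₂ ∈ B, b₁ ≠ b₂ ∧
      ∀ u ∈ C, ∀ u' ∈ C, ∀ w ∈ B, ∀ w' ∈ B,
        u + (1 + (c₁ - c₂) / (b₁ - b₂)) * w = u' + (1 + (c₁ - c₂) / (b₁ - b₂)) * w' → w = w' := by
  set R : ZMod p → Prop := fun r => ∃ c₁ ∈ C, ∃ c₂ ∈ C, ∃ b₁ ∈ B, ∃ b₂ ∈ B, b₁ ≠ b₂ ∧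
      r = (c₁ - c₂) / (b₁ - b₂)
  by_cases h : ∀ r, R r → R (1 + r)
  · left
    have hnat : ∀ k : ℕ, R k := by
      intro k
      induction k with
      | zero =>
        obtain ⟨c, hc⟩ := hC
        obtain ⟨b₁, hb₁, b₂, hb₂, hne⟩ := one_lt_card.1 hB
        exact ⟨c, hc, c, hc, b₁, hb₁, b₂, hb₂, hne, by simp⟩
      | succ k ih =>
        have := h _ ih
        rwa [add_comm, ← Nat.cast_succ] at this
    intro r
    have := hnat r.val
    rwa [ZMod.natCast_zmod_val] at this
  · right
    push Not at h
    obtain ⟨r, ⟨c₁, hc₁, c₂, hc₂, b₁, hb₁, b₂, hb₂, hne, rfl⟩, hr⟩ := h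
    refine ⟨c₁, hc₁, c₂, hc₂, b₁, hb₁, b₂, hb₂, hne, fun u hu u' hu' w hw w' hw' he => ?_⟩
    by_contra hww
    refine hr ⟨u, hu, u', hu', w', hw', w, hw, Ne.symm hww, ?_⟩
    rw [eq_div_iff (sub_ne_zero.2 (Ne.symm hww))]
    linear_combination -he

open scoped Combinatorics.Additive in
/-- If `#C * #B < p` then some nonzero dilate of `B` has small additive energy with `C`. -/
lemma exists_smul_addEnergy_le {B C : Finset (ZMod p)} (h : #C * #B < p) :
    ∃ x : ZMod p, x ≠ 0 ∧ E[C, x • B] ≤ 2 * (#C * #B) := by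
  have hp1 : 1 < p := (Fact.out : p.Prime).one_lt
  set T : Finset ((ZMod p × ZMod p) × (ZMod p × ZMod p)) := (C ×ˢ C) ×ˢ (B ×ˢ B) with hT
  set N : ZMod p → ℕ := fun x => #{q ∈ T | q.1.1 + x * q.2.1 = q.1.2 + x * q.2.2}
  have hE : ∀ x, E[C, x • B] ≤ N x := by
    intro x
    refine card_le_card_of_surjOn (fun q => (q.1, (x * q.2.1, x * q.2.2))) ?_
    rintro ⟨⟨c, c'⟩, d, d'⟩ hq
    simp only [coe_filter, mem_product, Set.mem_ofPred_eq, mem_smul_finset, smul_eq_mul] at hq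
    obtain ⟨⟨⟨hc, hc'⟩, ⟨b, hb, rfl⟩, ⟨b', hb', rfl⟩⟩, he⟩ := hq
    exact ⟨((c, c'), (b, b')), by simp [hT, hc, hc', hb, hb', he], rfl⟩
  have hsum : ∑ x ∈ univ.erase 0, N x ≤ (p - 1) * (#C * #B) + #T := by
    have h1 := sum_card_bipartiteAbove_eq_sum_card_bipartiteBelow (s := univ.erase (0 : ZMod p))
      (t := T) (fun x q => q.1.1 + x * q.2.1 = q.1.2 + x * q.2.2)
    change ∑ x ∈ univ.erase 0, N x = _ at h1
    rw [h1]
    set D := {q ∈ T | q.1.1 = q.1.2 ∧ q.2.1 = q.2.2}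
    have hD : #D ≤ #C * #B := by
      rw [← card_product]
      refine card_le_card_of_injOn (fun q => (q.1.1, q.2.1)) ?_ ?_
      · intro q hq
        simp only [D, hT, coe_filter, mem_product, Set.mem_ofPred_eq] at hq
        simp [hq.1.1.1, hq.1.2.1]
      · rintro ⟨⟨a, b⟩, c, d⟩ hq ⟨⟨a', b'⟩, c', d'⟩ hq' he
        simp only [D, coe_filter, Set.mem_ofPred_eq] at hq hq'
        simp only [Prod.mk.injEq] at he ⊢
        obtain ⟨-, rfl, rfl⟩ := hq
        obtain ⟨-, rfl, rfl⟩ := hq'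
        exact ⟨⟨he.1, he.1⟩, he.2, he.2⟩
    calc _ ≤ ∑ q ∈ T, ((if q.1.1 = q.1.2 ∧ q.2.1 = q.2.2 then p - 1 else 0) + 1) := by
          refine sum_le_sum fun q _ => ?_
          split_ifs with hq
          · refine (card_filter_le _ _).trans ?_
            rw [card_erase_of_mem (mem_univ _), card_univ, ZMod.card]
            omega
          · rw [zero_add, card_le_one]
            intro x hx y hy
            simp only [bipartiteBelow, mem_filter] at hx hy
            by_contra hxy
            have hb : q.2.1 = q.2.2 := by
              have : (x - y) * (q.2.1 - q.2.2) = 0 := by linear_combination hx.2 - hy.2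
              rcases mul_eq_zero.1 this with h | h
              · exact absurd (sub_eq_zero.1 h) hxy
              · exact sub_eq_zero.1 h
            refine hq ⟨?_, hb⟩
            have := hx.2
            rw [hb] at this
            exact add_right_cancel this
      _ = #D * (p - 1) + #T := by
          rw [sum_add_distrib, ← sum_filter, sum_const, sum_const, smul_eq_mul, smul_eq_mul,
            mul_one]
      _ ≤ _ := by rw [mul_comm #D]; gcongr
  have hTc : #T ≤ (p - 1) * (#C * #B) := by
    calc #T = (#C * #B) * (#C * #B) := by rw [hT]; simp only [card_product]; ring
      _ ≤ _ := Nat.mul_le_mul_right _ (by omega)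
  obtain ⟨x, hx, hN⟩ : ∃ x ∈ univ.erase (0 : ZMod p), N x ≤ 2 * (#C * #B) := by
    refine exists_le_of_sum_le ⟨1, by simp⟩ ?_
    rw [sum_const, card_erase_of_mem (mem_univ _), card_univ, ZMod.card, smul_eq_mul]
    calc _ ≤ _ := hsum
      _ ≤ (p - 1) * (#C * #B) + (p - 1) * (#C * #B) := by gcongr
      _ = _ := by ring
  exact ⟨x, (mem_erase.1 hx).1, (hE x).trans hN⟩

lemma exists_forall_card_mul_card_sq_le {B C : Finset (ZMod p)} (hC : C.Nonempty)
    (h : #C * #B < p) :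
    ∃ x : ZMod p, ∀ W ⊆ B, #C * #W ^ 2 ≤ 2 * #B * #(C + x • W) := by
  obtain ⟨x, hx, hE⟩ := exists_smul_addEnergy_le h
  refine ⟨x, fun W hW => ?_⟩
  have h1 := le_card_add_mul_addEnergy C (x • W)
  have hW' : #(x • W) = #W := card_image_of_injective _ (mul_right_injective₀ hx)
  rw [hW'] at h1
  have h2 := (addEnergy_mono_right (s := C) (smul_finset_subset_smul_finset (a := x) hW)).trans hE
  refine Nat.le_of_mul_le_mul_right ?_ hC.card_pos
  calc #C * #W ^ 2 * #C = #C ^ 2 * #W ^ 2 := by ring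
    _ ≤ _ := h1
    _ ≤ #(C + x • W) * (2 * (#C * #B)) := by gcongr
    _ = _ := by ring

/-- The sum-ratio estimate in `ZMod p`, with an explicit constant. -/
lemma card_pow_twelve_le {A : Finset (ZMod p)} (hA : ∀ a ∈ A, a ≠ 0) (hAp : #A ^ 2 < p) {M : ℝ}
    (hsum : #(A + A) ≤ M) (hdiv : #(A / A) ≤ M) : (#A : ℝ) ^ 12 ≤ 2 ^ 33 * M ^ 11 := by
  obtain rfl | hne := A.eq_empty_or_nonempty
  · have : 0 ≤ M := le_trans (by positivity) hsum
    rw [card_empty, Nat.cast_zero, zero_pow (by norm_num)]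
    positivity
  set m : ℝ := (#A : ℝ) with hm
  have hm0 : 0 < m := by rw [hm]; exact_mod_cast hne.card_pos
  have hmM : m ≤ M := le_trans (by rw [hm]; exact_mod_cast card_le_card_add_self) hsum
  have hM0 : 0 < M := hm0.trans_le hmM
  obtain hsmall | hbig := le_or_gt m 8
  · calc m ^ 12 = m * m ^ 11 := by ring
      _ ≤ 8 * M ^ 11 := by gcongr
      _ ≤ _ := by gcongr; norm_num
  obtain ⟨A', hA'A, hA', hQ⟩ := exists_half_subset_card_add_three_le (X := A) A
  have hA'm : (#A' : ℝ) ≤ m := by rw [hm]; exact_mod_cast card_le_card hA'A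
  have hmA' : m ≤ 2 * #A' := by rw [hm]; exact_mod_cast hA'
  set Q : ℝ := (#(A' + A + A + A) : ℝ)
  have hQ' : Q * m ^ 2 ≤ 8 * M ^ 3 := by
    refine le_of_mul_le_mul_right ?_ hm0
    calc Q * m ^ 2 * m = Q * m ^ 3 := by ring
      _ ≤ _ := hQ
      _ ≤ 8 * M ^ 3 * m := by gcongr
  set n : ℝ := m ^ 2 / (32 * M) with hn
  have hn0 : 0 < n := by positivity
  have hnM : n * M = m ^ 2 / 32 := by rw [hn]; field_simp
  have hA'ne : A'.Nonempty := card_pos.1 (Nat.cast_pos.1 (by linarith : (0 : ℝ) < #A'))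
  have hq : 8 * (n * #(A' / A')) ≤ (#A' : ℝ) ^ 2 := by
    have h1 : (#(A' / A') : ℝ) ≤ M :=
      le_trans (by exact_mod_cast card_le_card (div_subset_div hA'A hA'A)) hdiv
    calc 8 * (n * #(A' / A')) ≤ 8 * (n * M) := by gcongr
      _ = (m / 2) ^ 2 := by rw [hnM]; ring
      _ ≤ _ := by gcongr; linarith
  obtain ⟨x, hx, B, hBA', C, hCB, hA'C, hpB, hpC⟩ :=
    exists_popular_subsets A' (fun a ha => hA a (hA'A ha)) hA'ne hn0 hq
  have hBA := hBA'.trans hA'A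
  have hCA := hCB.trans hBA
  have hmC : m ≤ 4 * #C := by
    have : (#A' : ℝ) ≤ 2 * #C := by exact_mod_cast hA'C
    linarith
  have hBm : (#B : ℝ) ≤ m := by rw [hm]; exact_mod_cast card_le_card hBA
  have hCB' : (#C : ℝ) ≤ #B := by exact_mod_cast card_le_card hCB
  have hC0 : (0 : ℝ) < #C := by linarith
  have hCne : C.Nonempty := card_pos.1 (Nat.cast_pos.1 hC0)
  have hB1 : 1 < #B := by
    have : (1 : ℝ) < #B := by linarith
    exact_mod_cast this
  have hZ : ∀ b ∈ B, ∃ Z : Finset (ZMod p), n ≤ #Z ∧ Z ⊆ x • A ∧ Z ⊆ b • A := by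
    intro b hb
    have hb0 : b ≠ 0 := hA _ (hBA hb)
    refine ⟨b • {w ∈ A' | b * w ∈ x • A'}, ?_, ?_, ?_⟩
    · refine (hpB b hb).trans_eq (congrArg _ ?_)
      exact (card_image_of_injective _ (mul_right_injective₀ hb0)).symm
    · intro y hy
      obtain ⟨w, hw, rfl⟩ := mem_smul_finset.1 hy
      exact smul_finset_subset_smul_finset hA'A (mem_filter.1 hw).2
    · exact smul_finset_subset_smul_finset ((filter_subset _ _).trans hA'A)
  have key : ∀ c₁ ∈ C, ∀ c₂ ∈ C, ∀ b₁ ∈ B, ∀ b₂ ∈ B, b₁ ≠ b₂ →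
      #(C + ((c₁ - c₂) / (b₁ - b₂)) • {w ∈ B | c₁ * w ∈ x • A'}) * n ^ 3 ≤ Q * M ^ 3 := by
    intro c₁ hc₁ c₂ hc₂ b₁ hb₁ b₂ hb₂ hne
    refine card_add_div_smul_mul_pow_le hn0.le hsum hCA ((filter_subset _ _).trans hBA) hne ?_
      (hZ _ (hCB hc₂)) (hZ _ hb₁) (hZ _ hb₂)
    intro y hy
    obtain ⟨w, hw, rfl⟩ := mem_smul_finset.1 hy
    exact (mem_filter.1 hw).2
  obtain hall | ⟨c₁, hc₁, c₂, hc₂, b₁, hb₁, b₂, hb₂, hne, hinj⟩ :=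
    forall_or_exists_one_add_of_ratio_of_differences hCne hB1
  · obtain ⟨r, hr⟩ := exists_forall_card_mul_card_sq_le (B := B) hCne (by
      refine lt_of_le_of_lt ?_ hAp
      rw [sq]
      exact Nat.mul_le_mul (card_le_card hCA) (card_le_card hBA))
    obtain ⟨c₁, hc₁, c₂, hc₂, b₁, hb₁, b₂, hb₂, hne, rfl⟩ := hall r
    have hT := key c₁ hc₁ c₂ hc₂ b₁ hb₁ b₂ hb₂ hne
    have hW := hpC c₁ hc₁
    have hE := hr _ (filter_subset (fun w => c₁ * w ∈ x • A') B)
    generalize {w ∈ B | c₁ * w ∈ x • A'} = W at hT hW hE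
    have hE' : (#C : ℝ) * (#W : ℝ) ^ 2 ≤
        2 * #B * #(C + ((c₁ - c₂) / (b₁ - b₂)) • W) := by exact_mod_cast hE
    set T : ℝ := (#(C + ((c₁ - c₂) / (b₁ - b₂)) • W) : ℝ)
    have hnT : n ^ 2 ≤ 32 * T := by
      refine le_of_mul_le_mul_right ?_ hm0
      calc n ^ 2 * m = 16 * (m / 4 * (n / 2) ^ 2) := by ring
        _ ≤ 16 * (#C * (#W : ℝ) ^ 2) := by gcongr; linarith
        _ ≤ 16 * (2 * #B * T) := by gcongr
        _ ≤ 16 * (2 * m * T) := by gcongr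
        _ = 32 * T * m := by ring
    have h5 : n ^ 5 * m ^ 2 ≤ 2 ^ 8 * M ^ 6 := by
      calc n ^ 5 * m ^ 2 = n ^ 2 * n ^ 3 * m ^ 2 := by ring
        _ ≤ 32 * T * n ^ 3 * m ^ 2 := by gcongr
        _ = 32 * (T * n ^ 3) * m ^ 2 := by ring
        _ ≤ 32 * (Q * M ^ 3) * m ^ 2 := by gcongr
        _ = 32 * M ^ 3 * (Q * m ^ 2) := by ring
        _ ≤ 32 * M ^ 3 * (8 * M ^ 3) := by gcongr
        _ = _ := by ring
    calc m ^ 12 = 2 ^ 25 * (m ^ 2 / 32) ^ 5 * m ^ 2 := by ring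
      _ = 2 ^ 25 * (n * M) ^ 5 * m ^ 2 := by rw [hnM]
      _ = 2 ^ 25 * M ^ 5 * (n ^ 5 * m ^ 2) := by ring
      _ ≤ 2 ^ 25 * M ^ 5 * (2 ^ 8 * M ^ 6) := by gcongr
      _ = _ := by ring
  · have hT := key c₁ hc₁ c₂ hc₂ b₁ hb₁ b₂ hb₂ hne
    have hW := hpC c₁ hc₁
    have hWB := filter_subset (fun w => c₁ * w ∈ x • A') B
    generalize {w ∈ B | c₁ * w ∈ x • A'} = W at hT hW hWB
    generalize (c₁ - c₂) / (b₁ - b₂) = r at hT hinj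
    obtain ⟨U, hUC, hCU, hU⟩ := exists_half_subset_card_add_add_le (X := C) W (r • W)
    have hUW : #U * #W ≤ #(U + W + r • W) := by
      rw [← card_product]
      refine card_le_card_of_injOn (fun z => z.1 + (1 + r) * z.2) ?_ ?_
      · intro z hz
        rw [mem_coe, mem_product] at hz
        have e : z.1 + (1 + r) * z.2 = z.1 + z.2 + r • z.2 := by rw [smul_eq_mul]; ring
        simp only [e]
        exact add_mem_add (add_mem_add hz.1 hz.2) (smul_mem_smul_finset hz.2)
      · intro z hz z' hz' h
        rw [mem_coe, mem_product] at hz hz'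
        have h2 := hinj _ (hUC hz.1) _ (hUC hz'.1) _ (hWB hz.2) _ (hWB hz'.2) h
        refine Prod.ext ?_ h2
        simp only [h2] at h
        exact add_right_cancel h
    have hCW : (#(C + W) : ℝ) ≤ M :=
      le_trans (by exact_mod_cast card_le_card (add_subset_add hCA (hWB.trans hBA))) hsum
    have hUW' : (#U : ℝ) * #W ≤ #(U + W + r • W) := by exact_mod_cast hUW
    have hU0 : (0 : ℝ) < #U := by
      have : (#C : ℝ) ≤ 2 * #U := by exact_mod_cast hCU
      linarith
    set T : ℝ := (#(C + r • W) : ℝ)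
    have hnT : n * m ^ 2 ≤ 2 ^ 9 * M * T := by
      refine le_of_mul_le_mul_right ?_ hU0
      calc n * m ^ 2 * #U = 32 * (#U * (n / 2) * (m / 4) ^ 2) := by ring
        _ ≤ 32 * (#U * #W * (#C : ℝ) ^ 2) := by gcongr; linarith
        _ ≤ 32 * (#(U + W + r • W) * (#C : ℝ) ^ 2) := by gcongr
        _ ≤ 32 * (16 * #(C + W) * T * #U) := by gcongr
        _ ≤ 32 * (16 * M * T * #U) := by gcongr
        _ = _ := by ring
    have h5 : n ^ 4 * m ^ 4 ≤ 2 ^ 12 * M ^ 7 := by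
      calc n ^ 4 * m ^ 4 = n * m ^ 2 * n ^ 3 * m ^ 2 := by ring
        _ ≤ 2 ^ 9 * M * T * n ^ 3 * m ^ 2 := by gcongr
        _ = 2 ^ 9 * M * (T * n ^ 3) * m ^ 2 := by ring
        _ ≤ 2 ^ 9 * M * (Q * M ^ 3) * m ^ 2 := by gcongr
        _ = 2 ^ 9 * M ^ 4 * (Q * m ^ 2) := by ring
        _ ≤ 2 ^ 9 * M ^ 4 * (8 * M ^ 3) := by gcongr
        _ = _ := by ring
    calc m ^ 12 = 2 ^ 20 * (m ^ 2 / 32) ^ 4 * m ^ 4 := by ring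
      _ = 2 ^ 20 * (n * M) ^ 4 * m ^ 4 := by rw [hnM]
      _ = 2 ^ 20 * M ^ 4 * (n ^ 4 * m ^ 4) := by ring
      _ ≤ 2 ^ 20 * M ^ 4 * (2 ^ 12 * M ^ 7) := by gcongr
      _ = 2 ^ 32 * M ^ 11 := by ring
      _ ≤ _ := by gcongr <;> norm_num

end ZMod

theorem sum_product_Fp_ratio_sum :
    ∃ c : ℝ, c > 0 ∧ ∃ p₀ : ℕ, ∀ p : ℕ, p.Prime → p₀ ≤ p →
      ∀ (_ : Fact p.Prime) (A : Finset (ZMod p)),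
        (∀ a ∈ A, a ≠ 0) → 2 ≤ A.card → A.card ^ 2 < p →
        c * (A.card : ℝ) ^ (1 + 1 / 11 : ℝ) ≤
          max ((A / A).card : ℝ) ((A + A).card : ℝ) := by
  refine ⟨1 / 8, by norm_num, 0, fun p _ _ _ A hA _ hAp => ?_⟩
  have h := card_pow_twelve_le hA hAp (le_max_right ((A / A).card : ℝ) ((A + A).card : ℝ))
    (le_max_left ((A / A).card : ℝ) ((A + A).card : ℝ))
  have hM : 0 ≤ max ((A / A).card : ℝ) ((A + A).card : ℝ) := le_max_of_le_left (by positivity)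
  generalize max ((A / A).card : ℝ) ((A + A).card : ℝ) = M at h hM
  have h11 : ((A.card : ℝ) ^ (1 + 1 / 11 : ℝ)) ^ 11 ≤ (8 * M) ^ 11 := by
    rw [← Real.rpow_mul_natCast (by positivity)]
    calc (A.card : ℝ) ^ ((1 + 1 / 11 : ℝ) * (11 : ℕ)) = (A.card : ℝ) ^ (12 : ℕ) := by
          rw [← Real.rpow_natCast]; norm_num
      _ ≤ 2 ^ 33 * M ^ 11 := h
      _ = _ := by ring
  have := le_of_pow_le_pow_left₀ (by norm_num) (by positivity) h11
  linarith
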